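/- Subunitarity of m_k: for every k ≥ 1, the sum of m_k(s) over all nonempty binary strings s is strictly smaller than 1. -/

import Mathlib

/-- An instruction of a Busy Beaver machine: `Sum.inl b` means "write `b` and move to the
halting state (no head movement)"; `Sum.inr (q, b, d)` means "write `b`, move the head in
direction `d` (`true` = right, `false` = left) and change to state `q`".  For the class
`(n,2)` there are `4 * n + 2` instructions. -/
abbrev Instr (n : ℕ) := Bool ⊕ (Fin n × Bool × Bool)

/-- A Turing machine in the class `(n,2)`: a transition table assigning an instruction to
every pair (current state, read symbol). -/
abbrev Machine (n : ℕ) := (Fin n × Bool) → Instr n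

/-- A configuration: current state (`none` = halted), tape contents, head position, and the
interval `[lo, hi]` of cells visited so far by the head. -/
structure Config (n : ℕ) where
  state : Option (Fin n)
  tape : ℤ → Bool
  pos : ℤ
  lo : ℤ
  hi : ℤ

/-- One computation step. -/
def step {n : ℕ} (M : Machine n) (c : Config n) : Config n :=
  match c.state with
  | none => c
  | some q =>
    match M (q, c.tape c.pos) with
    | Sum.inl b => { c with state := none, tape := Function.update c.tape c.pos b }
    | Sum.inr (q', b, d) =>
      let p := c.pos + (if d then 1 else -1)
      { state := some q', tape := Function.update c.tape c.pos b,
        pos := p, lo := min c.lo p, hi := max c.hi p }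

/-- The initial configuration on a tape uniformly filled with the blank symbol `i`,
started in the initial state (state `⟨0, _⟩`, i.e. state "1" of `{1,…,n}`). -/
def initConfig (n : ℕ) (i : Bool) : Config n :=
  { state := if h : 0 < n then some ⟨0, h⟩ else none,
    tape := fun _ => i, pos := 0, lo := 0, hi := 0 }

/-- The configuration after `t` steps of the run `τ(i)`. -/
def cfgAt {n : ℕ} (M : Machine n) (i : Bool) (t : ℕ) : Config n :=
  (step M)^[t] (initConfig n i)

/-- A configuration is halted when the machine has entered the halting state. -/
def Halted {n : ℕ} (c : Config n) : Prop := c.state = none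

/-- The output read off a configuration: the symbols in the cells visited by the head. -/
def outputOf {n : ℕ} (c : Config n) : List Bool :=
  (List.range (c.hi - c.lo + 1).toNat).map fun j => c.tape (c.lo + j)

/-- `Outputs M i s` : the run `τ(i)` of `M` on blank symbol `i` halts with output `s`. -/
def Outputs {n : ℕ} (M : Machine n) (i : Bool) (s : List Bool) : Prop :=
  ∃ t, Halted (cfgAt M i t) ∧ outputOf (cfgAt M i t) = s

/-- `|{τ ∈ (n,2) : τ(i) = s}|`. -/
noncomputable def numOutput (n : ℕ) (i : Bool) (s : List Bool) : ℕ :=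
  Nat.card {τ : Machine n // Outputs τ i s}

/-- The exponent `n + 1 + ⌈log₂((4n+2)^(2n))⌉` (the length of the program encodings
with `n` states). -/
def expo (n : ℕ) : ℕ := n + 1 + Nat.clog 2 ((4 * n + 2) ^ (2 * n))

/-- The `n`-th term of the series defining `m(s)`. -/
noncomputable def mTerm (n : ℕ) (s : List Bool) : ℝ :=
  ((numOutput n false s + numOutput n true s : ℕ) : ℝ) / 2 ^ expo n

/-- The measure `m(s) = Σ_{n=1}^∞ (|{τ ∈ (n,2) : τ(0)=s}| + |{τ ∈ (n,2) : τ(1)=s}|) /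
2^(n+1+⌈log₂((4n+2)^(2n))⌉)`. -/
noncomputable def mDist (s : List Bool) : ℝ := ∑' j : ℕ, mTerm (j + 1) s

/-- The finite approximation `m_k(s)`: the same sum truncated to `1 ≤ n ≤ k`. -/
noncomputable def mApprox (k : ℕ) (s : List Bool) : ℝ :=
  ∑ n ∈ Finset.Icc 1 k, mTerm n s

/-- The finite approximation `m_k(s)` as a rational number. -/
noncomputable def mApproxQ (k : ℕ) (s : List Bool) : ℚ :=
  ∑ n ∈ Finset.Icc 1 k,
    ((numOutput n false s + numOutput n true s : ℕ) : ℚ) / 2 ^ expo n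

theorem Halted.iterate_step {n : ℕ} {M : Machine n} {c : Config n} (h : Halted c) (t : ℕ) :
    (step M)^[t] c = c := by
  have hfix : Function.IsFixedPt (step M) c := by
    unfold Halted at h
    simp [Function.IsFixedPt, step, h]
  exact hfix.iterate t

theorem Halted.cfgAt_eq_of_le {n : ℕ} {M : Machine n} {i : Bool} {t u : ℕ}
    (h : Halted (cfgAt M i t)) (htu : t ≤ u) : cfgAt M i u = cfgAt M i t := by
  obtain ⟨d, rfl⟩ := Nat.exists_eq_add_of_le' htu
  have := h.iterate_step (M := M) d
  rwa [cfgAt, ← Function.iterate_add_apply] at this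

/-- A run has at most one output. -/
theorem Outputs.unique {n : ℕ} {M : Machine n} {i : Bool} {s s' : List Bool}
    (h : Outputs M i s) (h' : Outputs M i s') : s = s' := by
  obtain ⟨t, ht, rfl⟩ := h
  obtain ⟨u, hu, rfl⟩ := h'
  rcases le_total t u with htu | hut
  · rw [ht.cfgAt_eq_of_le htu]
  · rw [hu.cfgAt_eq_of_le hut]

theorem card_machine (n : ℕ) : Fintype.card (Machine n) = (4 * n + 2) ^ (2 * n) := by
  simp only [Fintype.card_fun, Fintype.card_sum, Fintype.card_prod, Fintype.card_bool,
    Fintype.card_fin]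
  congr 1 <;> ring

theorem sum_numOutput_le (n : ℕ) (i : Bool) (F : Finset {s : List Bool // s ≠ []}) :
    ∑ s ∈ F, numOutput n i s.val ≤ (4 * n + 2) ^ (2 * n) := by
  classical
  rw [← card_machine, ← Finset.card_univ]
  have hcard (s : List Bool) :
      numOutput n i s = (Finset.univ.filter fun τ : Machine n => Outputs τ i s).card := by
    rw [numOutput, Nat.card_eq_fintype_card, Fintype.card_subtype]
  simp only [hcard]
  rw [← Finset.card_biUnion]
  · exact Finset.card_le_card (Finset.subset_univ _)
  · intro s _ s' _ hne
    rw [Function.onFun, Finset.disjoint_filter]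
    exact fun τ _ h h' => hne (Subtype.ext (h.unique h'))

theorem sum_mTerm_le (n : ℕ) (F : Finset {s : List Bool // s ≠ []}) :
    ∑ s ∈ F, mTerm n s.val ≤ (1 / 2 : ℝ) ^ n := by
  have hclog : (4 * n + 2) ^ (2 * n) ≤ 2 ^ Nat.clog 2 ((4 * n + 2) ^ (2 * n)) :=
    Nat.le_pow_clog one_lt_two _
  have hsum : ∑ s ∈ F, (numOutput n false s.val + numOutput n true s.val) ≤
      2 * 2 ^ Nat.clog 2 ((4 * n + 2) ^ (2 * n)) := by
    rw [Finset.sum_add_distrib]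
    have := sum_numOutput_le n false F
    have := sum_numOutput_le n true F
    omega
  simp only [mTerm]
  rw [← Finset.sum_div, div_le_iff₀ (by positivity), ← Nat.cast_sum]
  calc ((∑ s ∈ F, (numOutput n false s.val + numOutput n true s.val) : ℕ) : ℝ)
      ≤ 2 * 2 ^ Nat.clog 2 ((4 * n + 2) ^ (2 * n)) := by exact_mod_cast hsum
    _ = (1 / 2 : ℝ) ^ n * 2 ^ expo n := by
      rw [expo, pow_add, pow_add, one_div, inv_pow]
      field_simp

theorem sum_Icc_half_pow (k : ℕ) :
    ∑ n ∈ Finset.Icc 1 k, (1 / 2 : ℝ) ^ n = 1 - (1 / 2) ^ k := by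
  induction k with
  | zero => simp
  | succ k ih =>
    rw [Finset.sum_Icc_succ_top (by omega), ih]
    ring

theorem mApprox_nonneg (k : ℕ) (s : List Bool) : 0 ≤ mApprox k s :=
  Finset.sum_nonneg fun n _ => by unfold mTerm; positivity

/-- Subunitarity of `m_k`: for every `k ≥ 1`, the sum of `m_k(s)` over all nonempty binary
strings `s` is strictly smaller than `1`. -/
theorem mApprox_subunitary (k : ℕ) (hk : 1 ≤ k) :
    ∑' s : {s : List Bool // s ≠ []}, mApprox k s.val < 1 := by
  have hle : ∑' s : {s : List Bool // s ≠ []}, mApprox k s.val ≤ 1 - (1 / 2) ^ k := by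
    refine Real.tsum_le_of_sum_le (fun s => mApprox_nonneg k s.val) fun F => ?_
    simp only [mApprox]
    rw [Finset.sum_comm, ← sum_Icc_half_pow]
    exact Finset.sum_le_sum fun n _ => sum_mTerm_le n F
  have : (0 : ℝ) < (1 / 2) ^ k := by positivity
  linarith
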